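/- Fix an integer ν ≥ 1 and a real ε with 0 < ε ≤ 2. There exist constants C₁, C₂ > 0 (depending only on ν and ε) such that for every integer h ≥ 3, the set of σ ∈ ℂ for which |K_ν(h,σ) − ν!·h^ν| > h^{ν−ε/2}·exp(C₁·log h/log log h) has cardinality at most C₂·h^{1+ε}. -/

import Mathlib

section

open Polynomial

theorem Nat.card_primeFactors_filter_le (n : ℕ) {t : ℝ} (ht : 0 ≤ t) :
    ((n.primeFactors.filter fun p : ℕ => (p : ℝ) ≤ t).card : ℝ) ≤ t := by
  have hsub : (n.primeFactors.filter fun p : ℕ => (p : ℝ) ≤ t) ⊆ Finset.Icc 1 ⌊t⌋₊ := by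
    intro p hp
    rw [Finset.mem_filter] at hp
    rw [Finset.mem_Icc]
    exact ⟨(Nat.prime_of_mem_primeFactors hp.1).one_lt.le, Nat.le_floor hp.2⟩
  have := Finset.card_le_card hsub
  rw [Nat.card_Icc, Nat.add_sub_cancel] at this
  exact (Nat.cast_le.mpr this).trans (Nat.floor_le ht)

theorem Nat.log_card_divisors_le {n : ℕ} (hn : n ≠ 0) {t : ℝ} (ht : 1 < t) :
    Real.log n.divisors.card ≤
      t * Real.log (1 + 2 * Real.log n) + Real.log n / Real.log t := by
  have hlogt : 0 < Real.log t := Real.log_pos ht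
  have hlogn : 0 ≤ Real.log n := Real.log_natCast_nonneg n
  have hsum : Real.log n = ∑ p ∈ n.primeFactors, (n.factorization p : ℝ) * Real.log p := by
    rw [Real.log_nat_eq_sum_factorization]
    rfl
  have hterm : ∀ p ∈ n.primeFactors, Real.log ((n.factorization p : ℝ) + 1) ≤
      (if (p : ℝ) ≤ t then Real.log (1 + 2 * Real.log n) else 0) +
        (n.factorization p : ℝ) * Real.log p / Real.log t := by
    intro p hp
    have hpp := Nat.prime_of_mem_primeFactors hp
    have hlogp : 0 ≤ Real.log p := Real.log_natCast_nonneg p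
    have ha : (0 : ℝ) ≤ n.factorization p := Nat.cast_nonneg _
    split_ifs with hpt
    · have h1 : (n.factorization p : ℝ) * Real.log p ≤ Real.log n := by
        rw [hsum]
        exact Finset.single_le_sum
          (f := fun p => (n.factorization p : ℝ) * Real.log p)
          (fun q _ => mul_nonneg (Nat.cast_nonneg _) (Real.log_natCast_nonneg q)) hp
      have h2 : (1 : ℝ) / 2 ≤ Real.log p := by
        have : Real.log 2 ≤ Real.log p :=
          Real.log_le_log (by norm_num) (by exact_mod_cast hpp.two_le)
        linarith [Real.log_two_gt_d9]
      have h3 : Real.log ((n.factorization p : ℝ) + 1) ≤ Real.log (1 + 2 * Real.log n) := by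
        apply Real.log_le_log (by positivity)
        nlinarith
      have : 0 ≤ (n.factorization p : ℝ) * Real.log p / Real.log t := by positivity
      linarith
    · have h1 : Real.log ((n.factorization p : ℝ) + 1) ≤ n.factorization p := by
        have := Real.log_le_sub_one_of_pos (show 0 < (n.factorization p : ℝ) + 1 by positivity)
        linarith
      have h2 : Real.log t ≤ Real.log p := Real.log_le_log (by linarith) (not_le.mp hpt).le
      rw [zero_add, le_div_iff₀ hlogt]
      exact mul_le_mul h1 h2 hlogt.le ha
  have hcard : Real.log n.divisors.card =
      ∑ p ∈ n.primeFactors, Real.log ((n.factorization p : ℝ) + 1) := by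
    rw [Nat.card_divisors hn]
    push_cast
    rw [Real.log_prod]
    intro p _
    positivity
  rw [hcard]
  refine (Finset.sum_le_sum hterm).trans ?_
  rw [Finset.sum_add_distrib, ← Finset.sum_div, ← hsum, ← Finset.sum_filter, Finset.sum_const,
    nsmul_eq_mul]
  gcongr
  · exact Real.log_nonneg (by linarith)
  · exact Nat.card_primeFactors_filter_le n (by linarith)

theorem one_lt_log_natCast {h : ℕ} (hh : 3 ≤ h) : 1 < Real.log h := by
  rw [Real.lt_log_iff_exp_lt (by positivity)]
  have : (3 : ℝ) ≤ h := by exact_mod_cast hh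
  linarith [Real.exp_one_lt_d9]

theorem exists_card_divisors_le (k : ℕ) : ∃ C : ℝ, 0 < C ∧ ∀ h : ℕ, 3 ≤ h → ∀ n : ℕ, n ≠ 0 →
    n ≤ h ^ k → (n.divisors.card : ℝ) ≤ Real.exp (C * (Real.log h / Real.log (Real.log h))) := by
  refine ⟨16 * (1 + 2 * k) + 2 * k, by positivity, fun h hh n hn hnk => ?_⟩
  have hu : 1 < Real.log h := one_lt_log_natCast hh
  have hlogn : Real.log n ≤ k * Real.log h := by
    rw [← Real.log_pow]
    exact Real.log_le_log (by positivity) (by exact_mod_cast hnk)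
  have hlogn0 : 0 ≤ Real.log n := Real.log_natCast_nonneg n
  generalize Real.log h = u at *
  have hlogu : 0 < Real.log u := Real.log_pos hu
  have hsq : 1 < √u := by rw [Real.lt_sqrt] <;> linarith
  have hdiv := Nat.log_card_divisors_le hn hsq
  rw [Real.log_sqrt (by linarith)] at hdiv
  have hcard : (0 : ℝ) < n.divisors.card := by
    exact_mod_cast Finset.card_pos.mpr (Nat.nonempty_divisors.mpr hn)
  rw [← Real.log_le_iff_le_exp hcard]
  refine hdiv.trans ?_
  set q : ℝ := u ^ (1 / 4 : ℝ) with hq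
  have hq0 : 0 ≤ q := by positivity
  have hqq : q * q = √u := by
    rw [hq, ← Real.rpow_add (by linarith), Real.sqrt_eq_rpow]
    norm_num
  have h1 : Real.log u ≤ 4 * q := by
    have := Real.log_le_rpow_div (show 0 ≤ u by linarith) (show (0 : ℝ) < 1 / 4 by norm_num)
    linarith
  have h2 : Real.log (1 + 2 * Real.log n) ≤ 4 * (1 + 2 * k) * q := by
    have hk : (1 : ℝ) ≤ 1 + 2 * k := by linarith [(Nat.cast_nonneg k : (0 : ℝ) ≤ k)]
    have ha : Real.log (1 + 2 * Real.log n) ≤ Real.log ((1 + 2 * k) * u) :=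
      Real.log_le_log (by linarith) (by nlinarith)
    have hb := Real.log_le_rpow_div (show 0 ≤ (1 + 2 * k) * u by positivity)
      (show (0 : ℝ) < 1 / 4 by norm_num)
    rw [Real.mul_rpow (by positivity) (by linarith), ← hq] at hb
    have hc : (1 + 2 * k : ℝ) ^ (1 / 4 : ℝ) ≤ 1 + 2 * k := by
      calc (1 + 2 * k : ℝ) ^ (1 / 4 : ℝ) ≤ (1 + 2 * k : ℝ) ^ (1 : ℝ) :=
            Real.rpow_le_rpow_of_exponent_le hk (by norm_num)
        _ = 1 + 2 * k := Real.rpow_one _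
    nlinarith
  have h3 : √u * Real.log (1 + 2 * Real.log n) ≤ 16 * (1 + 2 * k) * (u / Real.log u) := by
    rw [← mul_div_assoc, le_div_iff₀ hlogu]
    have h20 : 0 ≤ Real.log (1 + 2 * Real.log n) := Real.log_nonneg (by linarith)
    calc √u * Real.log (1 + 2 * Real.log n) * Real.log u
        ≤ √u * (4 * (1 + 2 * k) * q) * (4 * q) := by gcongr
      _ = 16 * (1 + 2 * k) * (√u * (q * q)) := by ring
      _ = 16 * (1 + 2 * k) * u := by rw [hqq, Real.mul_self_sqrt (by linarith)]
  have h4 : Real.log n / (Real.log u / 2) ≤ 2 * k * (u / Real.log u) := by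
    rw [← mul_div_assoc, div_le_div_iff₀ (by positivity) hlogu]
    nlinarith
  linarith

theorem Polynomial.mahlerMeasure_le_of_norm_eval_le {p : ℂ[X]} {B : ℝ} (hB1 : 1 ≤ B)
    (hB : ∀ z : ℂ, ‖z‖ = 1 → ‖p.eval z‖ ≤ B) : p.mahlerMeasure ≤ B := by
  by_cases hp : p = 0
  · rw [hp, mahlerMeasure_zero]
    linarith
  rw [← Real.log_le_log_iff (mahlerMeasure_pos_of_ne_zero hp) (by linarith),
    ← logMahlerMeasure_eq_log_MahlerMeasure, logMahlerMeasure_def]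
  refine Real.circleAverage_mono_on_of_le_circle p.intervalIntegrable_mahlerMeasure ?_
  intro z hz
  have hz1 : ‖z‖ = 1 := by simpa using hz
  rcases (norm_nonneg (p.eval z)).eq_or_lt with h0 | h0
  · rw [← h0, Real.log_zero]
    exact Real.log_nonneg hB1
  · exact Real.log_le_log h0 (hB z hz1)

theorem Polynomial.norm_eval_le_mahlerMeasure (p : ℂ[X]) {z : ℂ} (hz : ‖z‖ ≤ 1) :
    ‖p.eval z‖ ≤ 2 ^ p.natDegree * p.mahlerMeasure := by
  rw [eval_eq_sum_range]
  refine (norm_sum_le _ _).trans ?_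
  have hterm : ∀ i ∈ Finset.range (p.natDegree + 1), ‖p.coeff i * z ^ i‖ ≤
      (p.natDegree.choose i : ℝ) * p.mahlerMeasure := by
    intro i _
    rw [norm_mul, norm_pow]
    exact (mul_le_of_le_one_right (norm_nonneg _) (pow_le_one₀ (norm_nonneg _) hz)).trans
      (p.norm_coeff_le_choose_mul_mahlerMeasure i)
  refine (Finset.sum_le_sum hterm).trans_eq ?_
  rw [← Finset.sum_mul]
  congr 1
  exact_mod_cast Nat.sum_range_choose p.natDegree

/-- Every complex number `s` has an integer polynomial (zero if `s` is transcendental) generating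
the ideal of integer polynomials which vanish at `s`. -/
theorem exists_aeval_eq_zero_iff_dvd (s : ℂ) :
    ∃ q : ℤ[X], ∀ P : ℤ[X], aeval s P = 0 ↔ q ∣ P := by
  by_cases hs : ∃ P : ℤ[X], P ≠ 0 ∧ aeval s P = 0
  · obtain ⟨P₀, hP₀, hP₀s⟩ := hs
    have hs_int : IsIntegral ℚ s := by
      rw [← isAlgebraic_iff_isIntegral]
      refine ⟨P₀.map (algebraMap ℤ ℚ), ?_, ?_⟩
      · exact (Polynomial.map_ne_zero_iff (algebraMap ℤ ℚ).injective_int).mpr hP₀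
      · exact (aeval_map_algebraMap ℚ s P₀).trans hP₀s
    have hp0 : minpoly ℚ s ≠ 0 := minpoly.ne_zero hs_int
    obtain ⟨b, hbm, hb⟩ :=
      IsLocalization.integerNormalization_spec (nonZeroDivisors ℤ) (minpoly ℚ s)
    have hb0 : b ≠ 0 := nonZeroDivisors.ne_zero hbm
    set N := IsLocalization.integerNormalization (nonZeroDivisors ℤ) (minpoly ℚ s) with hN
    have hN0 : N ≠ 0 := by
      intro h0
      rw [h0, Polynomial.map_zero] at hb
      exact (smul_ne_zero hb0 hp0) hb.symm
    have hc0 : N.content ≠ 0 := fun h0 => hN0 (content_eq_zero_iff.mp h0)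
    have hmap : C (N.content : ℚ) * N.primPart.map (algebraMap ℤ ℚ) =
        C (b : ℚ) * minpoly ℚ s := by
      have h1 : N.map (algebraMap ℤ ℚ) =
          C (N.content : ℚ) * N.primPart.map (algebraMap ℤ ℚ) := by
        conv_lhs => rw [N.eq_C_content_mul_primPart]
        simp
      rw [← h1, hb, ← smul_eq_C_mul]
      exact (Int.cast_smul_eq_zsmul ℚ b _).symm
    have hbu : IsUnit (C (b : ℚ)) := isUnit_C.mpr (by simpa using hb0)
    have hcu : IsUnit (C (N.content : ℚ)) := isUnit_C.mpr (by simpa using hc0)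
    refine ⟨N.primPart, fun P => ?_⟩
    rw [IsPrimitive.dvd_iff_fraction_map_dvd_fraction_map ℚ N.isPrimitive_primPart,
      ← hcu.mul_left_dvd, hmap, hbu.mul_left_dvd, minpoly.dvd_iff, aeval_map_algebraMap]
  · push Not at hs
    refine ⟨0, fun P => ⟨fun hP => ?_, fun hP => ?_⟩⟩
    · by_contra hne
      exact hs P (fun h0 => hne (h0 ▸ dvd_rfl)) hP
    · rw [zero_dvd_iff.mp hP, map_zero]

/-- The Mahler measure of an integer polynomial with respect to the circle of radius `h`. -/
noncomputable def Polynomial.scaledMahlerMeasure (h : ℕ) (q : ℤ[X]) : ℝ :=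
  ((q.map (Int.castRingHom ℂ)).comp (C (h : ℂ) * X)).mahlerMeasure

theorem Polynomial.scaledMahlerMeasure_mul (h : ℕ) (p q : ℤ[X]) :
    (p * q).scaledMahlerMeasure h = p.scaledMahlerMeasure h * q.scaledMahlerMeasure h := by
  simp only [scaledMahlerMeasure, Polynomial.map_mul, mul_comp, mahlerMeasure_mul]

theorem Polynomial.scaledMahlerMeasure_nonneg (h : ℕ) (p : ℤ[X]) :
    0 ≤ p.scaledMahlerMeasure h := mahlerMeasure_nonneg _

theorem Polynomial.abs_eval_le_scaledMahlerMeasure {h : ℕ} (hh : h ≠ 0) (g : ℤ[X]) {a : ℤ}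
    (ha : |a| ≤ h) : |((g.eval a : ℤ) : ℝ)| ≤ 2 ^ g.natDegree * g.scaledMahlerMeasure h := by
  have hh' : (h : ℂ) ≠ 0 := by exact_mod_cast hh
  have hhr : (0 : ℝ) < h := by positivity
  have hz : ‖(a : ℂ) / h‖ ≤ 1 := by
    rw [norm_div, Complex.norm_intCast, Complex.norm_natCast, div_le_one hhr]
    exact_mod_cast ha
  have := norm_eval_le_mahlerMeasure ((g.map (Int.castRingHom ℂ)).comp (C (h : ℂ) * X)) hz
  have hdeg : ((g.map (Int.castRingHom ℂ)).comp (C (h : ℂ) * X)).natDegree = g.natDegree := by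
    rw [natDegree_comp, natDegree_C_mul_X _ hh', mul_one,
      natDegree_map_eq_of_injective (Int.castRingHom ℂ).injective_int]
  rw [hdeg, eval_comp, eval_mul, eval_C, eval_X, mul_div_cancel₀ _ hh'] at this
  have hev : (g.map (Int.castRingHom ℂ)).eval (a : ℂ) = ((g.eval a : ℤ) : ℂ) := by
    simp
  rw [hev, Complex.norm_intCast] at this
  exact this

theorem Polynomial.scaledMahlerMeasure_prod_sub_prod_le {h k : ℕ} (hh : h ≠ 0)
    {x y : Fin k → ℤ} (hx : ∀ i, |x i| ≤ h) (hy : ∀ i, |y i| ≤ h) :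
    (∏ i, (X - C (x i)) - ∏ i, (X - C (y i)) : ℤ[X]).scaledMahlerMeasure h ≤
      2 * (2 * h) ^ k := by
  have hh1 : (1 : ℝ) ≤ h := by exact_mod_cast Nat.one_le_iff_ne_zero.mpr hh
  apply mahlerMeasure_le_of_norm_eval_le
  · have : (1 : ℝ) ≤ (2 * h) ^ k := one_le_pow₀ (by linarith)
    linarith
  intro z hz
  have key : ∀ x : Fin k → ℤ, (∀ i, |x i| ≤ h) → ‖∏ i, ((h : ℂ) * z - x i)‖ ≤ (2 * h) ^ k := by
    intro x hx
    rw [norm_prod]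
    calc ∏ i, ‖(h : ℂ) * z - x i‖ ≤ ∏ _i : Fin k, (2 * h : ℝ) := by
          refine Finset.prod_le_prod (fun i _ => norm_nonneg _) (fun i _ => ?_)
          refine (norm_sub_le _ _).trans ?_
          rw [norm_mul, hz, Complex.norm_natCast, Complex.norm_intCast]
          have : (|x i| : ℝ) ≤ h := by exact_mod_cast hx i
          linarith
      _ = (2 * h) ^ k := by simp
  have heval : ((Polynomial.map (Int.castRingHom ℂ)
      (∏ i, (X - C (x i)) - ∏ i, (X - C (y i)))).comp (C (h : ℂ) * X)).eval z =
      ∏ i, ((h : ℂ) * z - x i) - ∏ i, ((h : ℂ) * z - y i) := by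
    simp [eval_comp, Polynomial.map_prod, eval_prod]
  rw [heval]
  refine (norm_sub_le _ _).trans ?_
  linarith [key x hx, key y hy]

theorem Polynomial.abs_coeff_mul_pow_le_scaledMahlerMeasure {h : ℕ} (hh : h ≠ 0) (q : ℤ[X])
    (n : ℕ) :
    |(q.coeff n : ℝ)| * h ^ n ≤ q.natDegree.choose n * q.scaledMahlerMeasure h := by
  have hh' : (h : ℂ) ≠ 0 := by exact_mod_cast hh
  have := norm_coeff_le_choose_mul_mahlerMeasure n
    ((q.map (Int.castRingHom ℂ)).comp (C (h : ℂ) * X))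
  rw [natDegree_comp, natDegree_C_mul_X _ hh', mul_one,
    natDegree_map_eq_of_injective (Int.castRingHom ℂ).injective_int, comp_C_mul_X_coeff,
    coeff_map, norm_mul, norm_pow, Complex.norm_natCast, eq_intCast, Complex.norm_intCast] at this
  exact this

/-- If an integer polynomial with a complex root has Mahler measure less than `h ^ 2` on the circle
of radius `h`, then the root is rational with numerator and denominator bounded accordingly. -/
theorem exists_rational_root_of_scaledMahlerMeasure_lt {h : ℕ} (hh : 1 ≤ h) {q : ℤ[X]}
    (hq : q ≠ 0) {s : ℂ} (hs : aeval s q = 0) (hM : q.scaledMahlerMeasure h < (h : ℝ) ^ 2) :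
    ∃ a b : ℤ, |(a : ℝ)| ≤ q.scaledMahlerMeasure h ∧ |(b : ℝ)| * h ≤ q.scaledMahlerMeasure h ∧
      s = a / b := by
  have hh0 : h ≠ 0 := by omega
  have hlc : 1 ≤ |(q.leadingCoeff : ℝ)| := by
    exact_mod_cast Int.one_le_abs (leadingCoeff_ne_zero.mpr hq)
  have hdeg : q.natDegree < 2 := by
    by_contra hcon
    have h1 := abs_coeff_mul_pow_le_scaledMahlerMeasure hh0 q q.natDegree
    rw [Nat.choose_self, Nat.cast_one, one_mul, coeff_natDegree] at h1
    have h2 : (h : ℝ) ^ 2 ≤ (h : ℝ) ^ q.natDegree :=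
      pow_le_pow_right₀ (by exact_mod_cast hh) (not_lt.mp hcon)
    nlinarith [pow_nonneg (Nat.cast_nonneg h : (0 : ℝ) ≤ h) q.natDegree]
  have hdeg1 : q.natDegree = 1 := by
    by_contra hcon
    obtain ⟨c, hc⟩ := natDegree_eq_zero.mp (show q.natDegree = 0 by omega)
    rw [← hc, aeval_C] at hs
    apply hq
    rw [← hc, C_eq_zero]
    simpa using hs
  have h0 := abs_coeff_mul_pow_le_scaledMahlerMeasure hh0 q 0
  have h1 := abs_coeff_mul_pow_le_scaledMahlerMeasure hh0 q 1
  simp only [hdeg1, Nat.choose_self, Nat.cast_one, one_mul, pow_one, pow_zero, mul_one,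
    Nat.choose_zero_right] at h0 h1
  refine ⟨-q.coeff 0, q.coeff 1, by simpa using h0, h1, ?_⟩
  have hc1 : (q.coeff 1 : ℂ) ≠ 0 := by
    rw [leadingCoeff, hdeg1] at hlc
    intro hc
    have : q.coeff 1 = 0 := by exact_mod_cast hc
    rw [this] at hlc
    norm_num at hlc
  rw [q.eq_X_add_C_of_natDegree_le_one hdeg1.le] at hs
  simp only [map_add, map_mul, aeval_X, map_intCast, eq_intCast] at hs
  rw [eq_div_iff hc1]
  push_cast
  linear_combination hs

/-- The integer points of the cube `[1, h] ^ k`. -/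
noncomputable def intBox (k h : ℕ) : Finset (Fin k → ℤ) :=
  Fintype.piFinset fun _ => Finset.Icc 1 (h : ℤ)

theorem mem_intBox {k h : ℕ} {x : Fin k → ℤ} : x ∈ intBox k h ↔ ∀ i, 1 ≤ x i ∧ x i ≤ h := by
  simp [intBox, Fintype.mem_piFinset]

theorem card_intBox (k h : ℕ) : (intBox k h).card = h ^ k := by
  simp [intBox]

/-- The difference of the monic polynomials with root systems `x` and `y`. -/
noncomputable def diffPoly {k : ℕ} (x y : Fin k → ℤ) : ℤ[X] :=
  ∏ i, (X - C (x i)) - ∏ i, (X - C (y i))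

theorem eval_diffPoly_left {k : ℕ} (x y : Fin k → ℤ) (i : Fin k) :
    (diffPoly x y).eval (x i) = -∏ j, (x i - y j) := by
  have : ∏ j, (x i - x j) = 0 := Finset.prod_eq_zero (Finset.mem_univ i) (sub_self _)
  simp [diffPoly, eval_prod, this]

theorem eval_diffPoly_right {k : ℕ} (x y : Fin k → ℤ) (j : Fin k) :
    (diffPoly x y).eval (y j) = ∏ i, (y j - x i) := by
  have : ∏ i, (y j - y i) = 0 := Finset.prod_eq_zero (Finset.mem_univ j) (sub_self _)
  simp [diffPoly, eval_prod, this]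

theorem natDegree_diffPoly_le {k : ℕ} (x y : Fin k → ℤ) : (diffPoly x y).natDegree ≤ k := by
  have key : ∀ z : Fin k → ℤ, (∏ i, (X - C (z i))).natDegree ≤ k := by
    intro z
    refine (natDegree_prod_le _ _).trans ?_
    simp only [natDegree_X_sub_C, Finset.sum_const, Finset.card_univ, Fintype.card_fin,
      smul_eq_mul, mul_one, le_refl]
  exact (natDegree_sub_le _ _).trans (max_le (key x) (key y))

theorem aeval_diffPoly {k : ℕ} (x y : Fin k → ℤ) (s : ℂ) :
    aeval s (diffPoly x y) = ∏ i, (s - x i) - ∏ i, (s - y i) := by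
  simp [diffPoly]

theorem prod_eval_eq_of_dvd_diffPoly {k : ℕ} {x y : Fin k → ℤ} {q : ℤ[X]}
    (hq : q ∣ diffPoly x y) : ∏ i, q.eval (x i) = ∏ i, q.eval (y i) := by
  set Q : ℂ[X] := q.map (Int.castRingHom ℂ) with hQ
  have hcast : ∀ a : ℤ, ((q.eval a : ℤ) : ℂ) =
      Q.leadingCoeff * (Q.roots.map fun r => (a - r : ℂ)).prod := by
    intro a
    rw [← (IsAlgClosed.splits Q).eval_eq_prod_roots, hQ]
    simp
  have hroot : ∀ r ∈ Q.roots, ∏ i, ((x i : ℂ) - r) = ∏ i, ((y i : ℂ) - r) := by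
    intro r hr
    have hr0 : aeval r q = 0 := by
      have := (mem_roots'.mp hr).2
      rwa [IsRoot, hQ, eval_map] at this
    obtain ⟨g, hg⟩ := hq
    have h0 : aeval r (diffPoly x y) = 0 := by rw [hg, map_mul, hr0, zero_mul]
    rw [aeval_diffPoly, sub_eq_zero] at h0
    have hneg : ∀ z : Fin k → ℤ, ∏ i, ((z i : ℂ) - r) = (-1) ^ k * ∏ i, (r - z i) := by
      intro z
      simp_rw [← neg_sub r]
      rw [Finset.prod_neg]
      simp
    rw [hneg, hneg, h0]
  have : ((∏ i, q.eval (x i) : ℤ) : ℂ) = ((∏ i, q.eval (y i) : ℤ) : ℂ) := by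
    push_cast
    simp_rw [hcast]
    rw [Finset.prod_mul_distrib, Finset.prod_mul_distrib, ← Multiset.prod_map_prod,
      ← Multiset.prod_map_prod, Multiset.map_congr rfl hroot]
  exact_mod_cast this

theorem card_filter_eval_dvd_le (S : Finset ℤ) {F : ℤ[X]} (hF : 1 ≤ F.natDegree) {w : ℤ}
    (hw : w ≠ 0) {D : ℕ} (hD : w.natAbs.divisors.card ≤ D) :
    (S.filter fun z => F.eval z ∣ w).card ≤ F.natDegree * (2 * D) := by
  classical
  set t : Finset ℤ := w.natAbs.divisors.image (fun n : ℕ => (n : ℤ)) ∪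
    w.natAbs.divisors.image (fun n : ℕ => -(n : ℤ)) with ht
  have htc : t.card ≤ 2 * D := by
    refine (Finset.card_union_le _ _).trans ?_
    have h1 := (Finset.card_image_le (s := w.natAbs.divisors) (f := fun n : ℕ => (n : ℤ)))
    have h2 := (Finset.card_image_le (s := w.natAbs.divisors) (f := fun n : ℕ => -(n : ℤ)))
    omega
  refine (Finset.card_le_mul_card_image_of_maps_to (f := fun z => F.eval z) (t := t) ?_
    F.natDegree ?_).trans (Nat.mul_le_mul_left _ htc)
  · intro z hz
    have hdvd := (Finset.mem_filter.mp hz).2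
    have hmem : (F.eval z).natAbs ∈ w.natAbs.divisors :=
      Nat.mem_divisors.mpr ⟨Int.natAbs_dvd_natAbs.mpr hdvd, Int.natAbs_ne_zero.mpr hw⟩
    rw [ht, Finset.mem_union, Finset.mem_image, Finset.mem_image]
    rcases Int.natAbs_eq (F.eval z) with h | h
    · exact Or.inl ⟨_, hmem, h.symm⟩
    · exact Or.inr ⟨_, hmem, h.symm⟩
  · intro v _
    have hne : F - C v ≠ 0 := by
      intro h0
      have : (F - C v).natDegree = 0 := by rw [h0, natDegree_zero]
      rw [natDegree_sub_C] at this
      omega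
    calc _ ≤ (F - C v).roots.toFinset.card := by
          apply Finset.card_le_card
          intro z hz
          rw [Multiset.mem_toFinset, mem_roots hne, IsRoot, eval_sub, eval_C, sub_eq_zero]
          exact (Finset.mem_filter.mp hz).2
      _ ≤ (F - C v).roots.card := Multiset.toFinset_card_le _
      _ ≤ (F - C v).natDegree := card_roots' _
      _ = F.natDegree := natDegree_sub_C

open Classical in
/-- Pairs of points of the cube with different underlying multisets, such that the products
`∏ (s - x i)` and `∏ (s - y i)` are equal and do not vanish. -/
noncomputable def nontrivialPairs (k h : ℕ) (s : ℂ) : Finset ((Fin k → ℤ) × (Fin k → ℤ)) :=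
  (intBox k h ×ˢ intBox k h).filter fun xy =>
    diffPoly xy.1 xy.2 ≠ 0 ∧ aeval s (diffPoly xy.1 xy.2) = 0 ∧ ∀ i, s ≠ xy.1 i

open Classical in
/-- The elements of `nontrivialPairs` without common coordinates. -/
noncomputable def disjointPairs (k h : ℕ) (s : ℂ) : Finset ((Fin k → ℤ) × (Fin k → ℤ)) :=
  (nontrivialPairs k h s).filter fun xy => ∀ i j, xy.1 i ≠ xy.2 j

theorem mem_nontrivialPairs {k h : ℕ} {s : ℂ} {xy : (Fin k → ℤ) × (Fin k → ℤ)} :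
    xy ∈ nontrivialPairs k h s ↔ (xy.1 ∈ intBox k h ∧ xy.2 ∈ intBox k h) ∧
      diffPoly xy.1 xy.2 ≠ 0 ∧ aeval s (diffPoly xy.1 xy.2) = 0 ∧ ∀ i, s ≠ xy.1 i := by
  rw [nontrivialPairs, Finset.mem_filter, Finset.mem_product]

theorem mem_disjointPairs {k h : ℕ} {s : ℂ} {xy : (Fin k → ℤ) × (Fin k → ℤ)} :
    xy ∈ disjointPairs k h s ↔ xy ∈ nontrivialPairs k h s ∧ ∀ i j, xy.1 i ≠ xy.2 j := by
  rw [disjointPairs, Finset.mem_filter]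

theorem Int.natAbs_prod {ι : Type*} (t : Finset ι) (f : ι → ℤ) :
    (∏ i ∈ t, f i).natAbs = ∏ i ∈ t, (f i).natAbs :=
  map_prod Int.natAbsHom f t

theorem natAbs_prod_sub_le {k h : ℕ} {x : Fin k → ℤ} (hx : x ∈ intBox k h) {a : ℤ}
    (ha : 1 ≤ a ∧ a ≤ h) : (∏ i, (a - x i)).natAbs ≤ h ^ k := by
  rw [Int.natAbs_prod]
  calc ∏ i, (a - x i).natAbs ≤ ∏ _i : Fin k, h := by
        refine Finset.prod_le_prod' fun i _ => ?_
        have := mem_intBox.mp hx i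
        omega
    _ = h ^ k := by simp

theorem card_left_fiber_disjointPairs_le {k h D : ℕ} {s : ℂ} {q : ℤ[X]}
    (hq : ∀ P : ℤ[X], aeval s P = 0 ↔ q ∣ P)
    (hD : ∀ n : ℕ, n ≠ 0 → n ≤ (h ^ k) ^ k → n.divisors.card ≤ D) (y : Fin k → ℤ) :
    ((disjointPairs k h s).filter fun xy => xy.2 = y).card ≤ (k * (2 * D)) ^ k := by
  classical
  rcases ((disjointPairs k h s).filter fun xy => xy.2 = y).eq_empty_or_nonempty with he | ⟨xy₀, h₀⟩
  · rw [he, Finset.card_empty]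
    exact Nat.zero_le _
  rw [Finset.mem_filter, mem_disjointPairs, mem_nontrivialPairs] at h₀
  obtain ⟨⟨⟨⟨hx₀, hy₀⟩, hne₀, hs₀, -⟩, hdis₀⟩, hy⟩ := h₀
  rw [hy] at hy₀ hne₀ hs₀ hdis₀
  have hdvd₀ := (hq _).mp hs₀
  have hq0 : q ≠ 0 := by
    rintro rfl
    exact hne₀ (zero_dvd_iff.mp hdvd₀)
  have hdegk : q.natDegree ≤ k :=
    (natDegree_le_of_dvd hdvd₀ hne₀).trans (natDegree_diffPoly_le _ _)
  have hdeg1 : 1 ≤ q.natDegree := by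
    by_contra hcon
    obtain ⟨c, hc⟩ := natDegree_eq_zero.mp (show q.natDegree = 0 by omega)
    have hs := (hq q).mpr dvd_rfl
    rw [← hc, aeval_C] at hs
    apply hq0
    rw [← hc, C_eq_zero]
    simpa using hs
  have hval : ∀ j, (q.eval (y j)).natAbs ≠ 0 ∧ (q.eval (y j)).natAbs ≤ h ^ k := by
    intro j
    have hd : q.eval (y j) ∣ ∏ i, (y j - xy₀.1 i) := by
      rw [← eval_diffPoly_right]
      exact eval_dvd hdvd₀
    have hn : ∏ i, (y j - xy₀.1 i) ≠ 0 :=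
      Finset.prod_ne_zero_iff.mpr fun i _ => sub_ne_zero.mpr (hdis₀ i j).symm
    refine ⟨fun h0 => hn ?_, ?_⟩
    · rw [Int.natAbs_eq_zero.mp h0] at hd
      exact zero_dvd_iff.mp hd
    · exact (Nat.le_of_dvd (Int.natAbs_pos.mpr hn) (Int.natAbs_dvd_natAbs.mpr hd)).trans
        (natAbs_prod_sub_le hx₀ (mem_intBox.mp hy₀ j))
  set w := ∏ j, q.eval (y j) with hw
  have hw0 : w ≠ 0 :=
    Finset.prod_ne_zero_iff.mpr fun j _ => Int.natAbs_ne_zero.mp (hval j).1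
  have hwD : w.natAbs.divisors.card ≤ D := by
    refine hD _ (Int.natAbs_ne_zero.mpr hw0) ?_
    rw [hw, Int.natAbs_prod]
    calc ∏ j, (q.eval (y j)).natAbs ≤ ∏ _j : Fin k, h ^ k :=
          Finset.prod_le_prod' fun j _ => (hval j).2
      _ = (h ^ k) ^ k := by simp
  set V : Finset ℤ := (Finset.Icc 1 (h : ℤ)).filter fun z => q.eval z ∣ w with hV
  have hVc : V.card ≤ k * (2 * D) :=
    (card_filter_eval_dvd_le _ hdeg1 hw0 hwD).trans (Nat.mul_le_mul_right _ hdegk)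
  calc _ ≤ (Fintype.piFinset fun _ : Fin k => V).card := by
        refine Finset.card_le_card_of_injOn (fun xy => xy.1) ?_ ?_
        · intro xy hxy
          rw [Finset.mem_coe, Finset.mem_filter, mem_disjointPairs, mem_nontrivialPairs] at hxy
          obtain ⟨⟨⟨⟨hx, -⟩, -, hs, -⟩, -⟩, rfl⟩ := hxy
          rw [Finset.mem_coe, Fintype.mem_piFinset]
          intro i
          rw [hV, Finset.mem_filter, Finset.mem_Icc]
          refine ⟨mem_intBox.mp hx i, ?_⟩
          rw [hw, ← prod_eval_eq_of_dvd_diffPoly ((hq _).mp hs)]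
          exact Finset.dvd_prod_of_mem _ (Finset.mem_univ i)
        · intro xy hxy xy' hxy' heq
          rw [Finset.mem_coe, Finset.mem_filter] at hxy hxy'
          exact Prod.ext heq (hxy.2.trans hxy'.2.symm)
    _ = V.card ^ k := by simp
    _ ≤ (k * (2 * D)) ^ k := Nat.pow_le_pow_left hVc k

theorem card_disjointPairs_succ_le {k h D B : ℕ} {s : ℂ} {q : ℤ[X]}
    (hq : ∀ P : ℤ[X], aeval s P = 0 ↔ q ∣ P) (hh : 1 ≤ h)
    (hD : ∀ n : ℕ, n ≠ 0 → n ≤ (h ^ (k + 1)) ^ (k + 1) → n.divisors.card ≤ D)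
    (hB : ∀ xy ∈ disjointPairs (k + 1) h s, ∀ g : ℤ[X], diffPoly xy.1 xy.2 = q * g →
      |g.eval (xy.1 0)| ≤ B) :
    (disjointPairs (k + 1) h s).card ≤
      ((k + 1) * (2 * D)) ^ (k + 1) * ((2 * D) ^ (k + 1) * (h * (2 * B))) := by
  classical
  have hpow : h ^ (k + 1) ≤ (h ^ (k + 1)) ^ (k + 1) :=
    Nat.le_self_pow (Nat.succ_ne_zero k) _
  set I : Finset (ℤ × (Fin (k + 1) → ℤ)) :=
    (disjointPairs (k + 1) h s).image fun xy => (xy.1 0, xy.2) with hI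
  have hstep : (disjointPairs (k + 1) h s).card ≤ ((k + 1) * (2 * D)) ^ (k + 1) * I.card := by
    refine Finset.card_le_mul_card_image_of_maps_to
      (f := fun xy : (Fin (k + 1) → ℤ) × (Fin (k + 1) → ℤ) => (xy.1 0, xy.2))
      (fun xy hxy => Finset.mem_image_of_mem _ hxy) _ ?_
    intro b _
    refine (Finset.card_le_card ?_).trans (card_left_fiber_disjointPairs_le hq hD b.2)
    intro xy hxy
    rw [Finset.mem_filter] at hxy ⊢
    exact ⟨hxy.1, congrArg Prod.snd hxy.2⟩
  refine hstep.trans (Nat.mul_le_mul_left _ ?_)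
  have hfac : ∀ ay ∈ I, (1 ≤ ay.1 ∧ ay.1 ≤ h) ∧ ay.2 ∈ intBox (k + 1) h ∧
      ∃ n : ℤ, |n| ≤ B ∧ ∏ j, (ay.1 - ay.2 j) = q.eval ay.1 * n ∧
        ∏ j, (ay.1 - ay.2 j) ≠ 0 := by
    intro ay hay
    obtain ⟨xy, hxy, rfl⟩ := Finset.mem_image.mp hay
    have hxy' := hxy
    rw [mem_disjointPairs, mem_nontrivialPairs] at hxy'
    obtain ⟨⟨⟨hx, hy⟩, -, hs, -⟩, hdis⟩ := hxy'
    obtain ⟨g, hg⟩ := (hq _).mp hs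
    refine ⟨mem_intBox.mp hx 0, hy, -g.eval (xy.1 0), ?_, ?_, ?_⟩
    · rw [abs_neg]
      exact hB xy hxy g hg
    · have := congrArg (eval (xy.1 0)) hg
      rw [eval_diffPoly_left, eval_mul] at this
      rw [mul_neg, ← this, neg_neg]
    · exact Finset.prod_ne_zero_iff.mpr fun j _ => sub_ne_zero.mpr (hdis 0 j)
  have htc : (Finset.Icc 1 (h : ℤ) ×ˢ (Finset.Icc (-(B : ℤ)) B).erase 0).card = h * (2 * B) := by
    rw [Finset.card_product, Finset.card_erase_of_mem (by simp), Int.card_Icc, Int.card_Icc]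
    congr 1 <;> omega
  rw [← htc]
  refine Finset.card_le_mul_card_image_of_maps_to
    (f := fun ay : ℤ × (Fin (k + 1) → ℤ) =>
      (ay.1, (∏ j, (ay.1 - ay.2 j)) / q.eval ay.1)) ?_ _ ?_
  · intro ay hay
    obtain ⟨ha, -, n, hn, hprod, hne⟩ := hfac ay hay
    rw [hprod] at hne
    rw [Finset.mem_product, Finset.mem_erase, Finset.mem_Icc, Finset.mem_Icc, hprod,
      Int.mul_ediv_cancel_left _ (left_ne_zero_of_mul hne)]
    exact ⟨ha, right_ne_zero_of_mul hne, abs_le.mp hn⟩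
  · rintro ⟨a, n⟩ -
    rcases (I.filter fun ay : ℤ × (Fin (k + 1) → ℤ) =>
      (ay.1, (∏ j, (ay.1 - ay.2 j)) / q.eval ay.1) = (a, n)).eq_empty_or_nonempty with
      he | ⟨ay₀, h₀⟩
    · rw [he, Finset.card_empty]
      exact Nat.zero_le _
    have hfib : ∀ ay ∈ I.filter fun ay : ℤ × (Fin (k + 1) → ℤ) =>
        (ay.1, (∏ j, (ay.1 - ay.2 j)) / q.eval ay.1) = (a, n),
        ay.1 = a ∧ ay.2 ∈ intBox (k + 1) h ∧ (1 ≤ a ∧ a ≤ h) ∧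
          ∏ j, (a - ay.2 j) = q.eval a * n ∧ q.eval a * n ≠ 0 := by
      intro ay hay
      rw [Finset.mem_filter, Prod.mk.injEq] at hay
      obtain ⟨hayI, rfl, rfl⟩ := hay
      obtain ⟨ha, hy, n, hn, hprod, hne⟩ := hfac ay hayI
      rw [hprod] at hne ⊢
      rw [Int.mul_ediv_cancel_left _ (left_ne_zero_of_mul hne)]
      exact ⟨rfl, hy, ha, rfl, hne⟩
    obtain ⟨-, hy₀, ha, hprod₀, hw0⟩ := hfib ay₀ h₀
    set w := q.eval a * n with hw
    have hwD : w.natAbs.divisors.card ≤ D := by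
      refine hD _ (Int.natAbs_ne_zero.mpr hw0) (le_trans ?_ hpow)
      rw [← hprod₀]
      exact natAbs_prod_sub_le hy₀ ha
    set V : Finset ℤ := (Finset.Icc 1 (h : ℤ)).filter fun z => (X - C a : ℤ[X]).eval z ∣ w with hV
    have hVc : V.card ≤ 2 * D := by
      have := card_filter_eval_dvd_le (Finset.Icc 1 (h : ℤ)) (F := X - C a)
        (natDegree_X_sub_C a).ge hw0 hwD
      rwa [natDegree_X_sub_C, one_mul] at this
    calc _ ≤ (Fintype.piFinset fun _ : Fin (k + 1) => V).card := by
          refine Finset.card_le_card_of_injOn (fun ay => ay.2) ?_ ?_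
          · intro ay hay
            obtain ⟨-, hy, -, hprod, -⟩ := hfib ay (Finset.mem_coe.mp hay)
            rw [Finset.mem_coe, Fintype.mem_piFinset]
            intro i
            rw [hV, Finset.mem_filter, Finset.mem_Icc, eval_sub, eval_X, eval_C]
            refine ⟨mem_intBox.mp hy i, ?_⟩
            rw [← hprod, ← neg_sub a, neg_dvd]
            exact Finset.dvd_prod_of_mem _ (Finset.mem_univ i)
          · intro ay hay ay' hay' heq
            exact Prod.ext ((hfib ay (Finset.mem_coe.mp hay)).1.trans
              (hfib ay' (Finset.mem_coe.mp hay')).1.symm) heq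
      _ = V.card ^ (k + 1) := by simp
      _ ≤ (2 * D) ^ (k + 1) := Nat.pow_le_pow_left hVc _

theorem card_disjointPairs_succ_mul_le {k h D : ℕ} {s : ℂ} {q : ℤ[X]}
    (hq : ∀ P : ℤ[X], aeval s P = 0 ↔ q ∣ P) (hh : 1 ≤ h)
    (hD : ∀ n : ℕ, n ≠ 0 → n ≤ (h ^ (k + 1)) ^ (k + 1) → n.divisors.card ≤ D) :
    (disjointPairs (k + 1) h s).card * q.scaledMahlerMeasure h ≤
      (((k + 1) * (2 * D)) ^ (k + 1) * (2 * D) ^ (k + 1) * (4 * 4 ^ (k + 1)) : ℝ) *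
        h ^ (k + 2) := by
  rcases eq_or_ne q 0 with rfl | hq0
  · have : (0 : ℤ[X]).scaledMahlerMeasure h = 0 := by simp [scaledMahlerMeasure]
    rw [this, mul_zero]
    positivity
  have hh0 : h ≠ 0 := by omega
  set M := q.scaledMahlerMeasure h with hM
  have hM0 : 0 < M := by
    have h1 := abs_coeff_mul_pow_le_scaledMahlerMeasure hh0 q q.natDegree
    rw [Nat.choose_self, Nat.cast_one, one_mul, coeff_natDegree] at h1
    have h2 : 0 < |(q.leadingCoeff : ℝ)| :=
      abs_pos.mpr (by exact_mod_cast leadingCoeff_ne_zero.mpr hq0)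
    exact lt_of_lt_of_le (by positivity) h1
  set β : ℝ := 2 ^ (k + 1) * (2 * (2 * h) ^ (k + 1)) / M with hβ
  have hβ0 : 0 ≤ β := by positivity
  have hB : ∀ xy ∈ disjointPairs (k + 1) h s, ∀ g : ℤ[X], diffPoly xy.1 xy.2 = q * g →
      |g.eval (xy.1 0)| ≤ (⌊β⌋₊ : ℤ) := by
    intro xy hxy g hg
    rw [mem_disjointPairs, mem_nontrivialPairs] at hxy
    obtain ⟨⟨⟨hx, hy⟩, hne, -, -⟩, -⟩ := hxy
    have habs : ∀ z ∈ intBox (k + 1) h, ∀ i, |z i| ≤ h := by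
      intro z hz i
      have := mem_intBox.mp hz i
      rw [abs_le]
      omega
    have hdeg : g.natDegree ≤ k + 1 :=
      (natDegree_le_of_dvd ⟨q, by rw [hg, mul_comm]⟩ hne).trans (natDegree_diffPoly_le _ _)
    have h1 := abs_eval_le_scaledMahlerMeasure hh0 g (habs _ hx 0)
    have h2 : M * g.scaledMahlerMeasure h ≤ 2 * (2 * h) ^ (k + 1) := by
      rw [hM, ← scaledMahlerMeasure_mul, ← hg]
      exact scaledMahlerMeasure_prod_sub_prod_le hh0 (habs _ hx) (habs _ hy)
    have h3 : |((g.eval (xy.1 0) : ℤ) : ℝ)| ≤ β := by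
      rw [hβ, le_div_iff₀ hM0]
      have hg0 := g.scaledMahlerMeasure_nonneg h
      calc |((g.eval (xy.1 0) : ℤ) : ℝ)| * M
          ≤ 2 ^ g.natDegree * g.scaledMahlerMeasure h * M := by gcongr
        _ ≤ 2 ^ (k + 1) * g.scaledMahlerMeasure h * M := by
            gcongr
            norm_num
        _ = 2 ^ (k + 1) * (M * g.scaledMahlerMeasure h) := by ring
        _ ≤ _ := by gcongr
    rw [Int.abs_eq_natAbs, Nat.cast_le, Nat.le_floor_iff hβ0]
    rwa [← Int.cast_abs, Int.abs_eq_natAbs, Int.cast_natCast] at h3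
  have hcard := card_disjointPairs_succ_le hq hh hD hB
  have hcard' : ((disjointPairs (k + 1) h s).card : ℝ) ≤
      ((k + 1) * (2 * D)) ^ (k + 1) * ((2 * D) ^ (k + 1) * (h * (2 * ⌊β⌋₊))) := by
    exact_mod_cast hcard
  have hfl : (⌊β⌋₊ : ℝ) * M ≤ 2 ^ (k + 1) * (2 * (2 * h) ^ (k + 1)) := by
    have := Nat.floor_le hβ0
    calc (⌊β⌋₊ : ℝ) * M ≤ β * M := by gcongr
      _ = _ := by rw [hβ, div_mul_cancel₀ _ hM0.ne']
  calc ((disjointPairs (k + 1) h s).card : ℝ) * M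
      ≤ (((k + 1) * (2 * D)) ^ (k + 1) * ((2 * D) ^ (k + 1) * (h * (2 * ⌊β⌋₊)))) * M := by
        gcongr
    _ = ((k + 1) * (2 * D)) ^ (k + 1) * (2 * D) ^ (k + 1) * (2 * h) * (⌊β⌋₊ * M) := by ring
    _ ≤ ((k + 1) * (2 * D)) ^ (k + 1) * (2 * D) ^ (k + 1) * (2 * h) *
          (2 ^ (k + 1) * (2 * (2 * h) ^ (k + 1))) := by gcongr
    _ = _ := by
        rw [show (4 : ℝ) = 2 * 2 by norm_num]
        simp only [mul_pow]
        ring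

theorem diffPoly_eq_mul {k : ℕ} {x y : Fin (k + 1) → ℤ} {i j : Fin (k + 1)} (hij : x i = y j) :
    diffPoly x y = (X - C (x i)) *
      diffPoly (fun l => x (i.succAbove l)) (fun l => y (j.succAbove l)) := by
  rw [diffPoly, diffPoly, Fin.prod_univ_succAbove _ i,
    Fin.prod_univ_succAbove (fun l => X - C (y l)) j, ← hij, mul_sub]

theorem card_le_mul_card_of_removal {k h : ℕ} {i j : Fin (k + 1)}
    {A : Finset ((Fin (k + 1) → ℤ) × (Fin (k + 1) → ℤ))}
    {B : Finset ((Fin k → ℤ) × (Fin k → ℤ))}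
    (hA : ∀ xy ∈ A, xy.1 ∈ intBox (k + 1) h ∧ xy.1 i = xy.2 j ∧
      ((fun l => xy.1 (i.succAbove l), fun l => xy.2 (j.succAbove l)) :
        (Fin k → ℤ) × (Fin k → ℤ)) ∈ B) :
    A.card ≤ h * B.card := by
  calc A.card ≤ (Finset.Icc 1 (h : ℤ) ×ˢ B).card := by
        refine Finset.card_le_card_of_injOn (fun xy =>
          (xy.1 i, (fun l => xy.1 (i.succAbove l), fun l => xy.2 (j.succAbove l)))) ?_ ?_
        · intro xy hxy
          obtain ⟨hx, -, hB⟩ := hA xy hxy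
          rw [Finset.mem_coe, Finset.mem_product, Finset.mem_Icc]
          exact ⟨mem_intBox.mp hx i, hB⟩
        · intro xy hxy xy' hxy' heq
          obtain ⟨-, h1, -⟩ := hA xy hxy
          obtain ⟨-, h2, -⟩ := hA xy' hxy'
          simp only [Prod.mk.injEq] at heq
          obtain ⟨h3, h4, h5⟩ := heq
          refine Prod.ext (funext fun l => ?_) (funext fun l => ?_)
          · rcases Fin.eq_self_or_eq_succAbove i l with rfl | ⟨m, rfl⟩
            · exact h3
            · exact congrFun h4 m
          · rcases Fin.eq_self_or_eq_succAbove j l with rfl | ⟨m, rfl⟩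
            · rw [← h1, ← h2, h3]
            · exact congrFun h5 m
    _ = h * B.card := by rw [Finset.card_product, Int.card_Icc]; simp

theorem intBox_removal {k h : ℕ} {x : Fin (k + 1) → ℤ} (hx : x ∈ intBox (k + 1) h)
    (i : Fin (k + 1)) : (fun l => x (i.succAbove l)) ∈ intBox k h :=
  mem_intBox.mpr fun l => mem_intBox.mp hx (i.succAbove l)

theorem card_nontrivialPairs_succ_le (k h : ℕ) (s : ℂ) :
    (nontrivialPairs (k + 1) h s).card ≤
      (disjointPairs (k + 1) h s).card + (k + 1) ^ 2 * (h * (nontrivialPairs k h s).card) := by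
  classical
  set U := (Finset.univ : Finset (Fin (k + 1) × Fin (k + 1))).biUnion fun ij =>
    (nontrivialPairs (k + 1) h s).filter fun xy => xy.1 ij.1 = xy.2 ij.2 with hU
  have hsub : nontrivialPairs (k + 1) h s ⊆ disjointPairs (k + 1) h s ∪ U := by
    intro xy hxy
    rw [Finset.mem_union]
    by_cases hdis : ∀ i j, xy.1 i ≠ xy.2 j
    · exact Or.inl (mem_disjointPairs.mpr ⟨hxy, hdis⟩)
    · push Not at hdis
      obtain ⟨i, j, hij⟩ := hdis
      refine Or.inr (Finset.mem_biUnion.mpr ⟨(i, j), Finset.mem_univ _, ?_⟩)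
      exact Finset.mem_filter.mpr ⟨hxy, hij⟩
  refine (Finset.card_le_card hsub).trans ((Finset.card_union_le _ _).trans ?_)
  refine Nat.add_le_add_left (Finset.card_biUnion_le.trans ?_) _
  calc _ ≤ ∑ _ij : Fin (k + 1) × Fin (k + 1), h * (nontrivialPairs k h s).card := by
        refine Finset.sum_le_sum fun ij _ => ?_
        refine card_le_mul_card_of_removal (i := ij.1) (j := ij.2) fun xy hxy => ?_
        rw [Finset.mem_filter, mem_nontrivialPairs] at hxy
        obtain ⟨⟨⟨hx, hy⟩, hne, hs, hsx⟩, hij⟩ := hxy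
        rw [diffPoly_eq_mul hij] at hne hs
        refine ⟨hx, hij, mem_nontrivialPairs.mpr ⟨⟨intBox_removal hx _, intBox_removal hy _⟩,
          right_ne_zero_of_mul hne, ?_, fun l => hsx _⟩⟩
        rw [map_mul] at hs
        refine (mul_eq_zero.mp hs).resolve_left ?_
        simpa [sub_eq_zero] using hsx ij.1
    _ = _ := by simp [sq]

theorem card_nontrivialPairs_zero (h : ℕ) (s : ℂ) : (nontrivialPairs 0 h s).card = 0 := by
  rw [Finset.card_eq_zero, Finset.eq_empty_iff_forall_notMem]
  intro xy hxy
  exact (mem_nontrivialPairs.mp hxy).2.1 (by simp [diffPoly])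

theorem card_nontrivialPairs_mul_le {ν h D : ℕ} {s : ℂ} {q : ℤ[X]}
    (hq : ∀ P : ℤ[X], aeval s P = 0 ↔ q ∣ P) (hh : 1 ≤ h) (hD1 : 1 ≤ D)
    (hD : ∀ n : ℕ, n ≠ 0 → n ≤ h ^ (ν * ν) → n.divisors.card ≤ D) {k : ℕ} (hk : k ≤ ν) :
    (nontrivialPairs k h s).card * q.scaledMahlerMeasure h ≤
      ((ν * (2 * D)) ^ ν * (2 * D) ^ ν * (4 * 4 ^ ν) : ℝ) * (ν ^ 2 + 1) ^ k * h ^ (k + 1) := by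
  have hD1' : (1 : ℝ) ≤ D := by exact_mod_cast hD1
  set c : ℝ := (ν * (2 * D)) ^ ν * (2 * D) ^ ν * (4 * 4 ^ ν) with hc
  have hc0 : 0 ≤ c := by positivity
  have hM := q.scaledMahlerMeasure_nonneg h
  induction k with
  | zero =>
    rw [card_nontrivialPairs_zero]
    have : 0 ≤ c * (ν ^ 2 + 1) ^ 0 * (h : ℝ) ^ (0 + 1) := by positivity
    simpa using this
  | succ k ih =>
    have ih := ih (by omega)
    have hkν : ((k : ℝ) + 1) ≤ ν := by exact_mod_cast hk
    have hdis := card_disjointPairs_succ_mul_le (k := k) hq hh (D := D) (by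
      intro n hn hnk
      refine hD n hn (hnk.trans ?_)
      rw [← pow_mul]
      exact Nat.pow_le_pow_right hh (Nat.mul_le_mul hk hk))
    have hck : (((k + 1) * (2 * D)) ^ (k + 1) * (2 * D) ^ (k + 1) * (4 * 4 ^ (k + 1)) : ℝ) ≤ c := by
      have h1 : (1 : ℝ) ≤ ν * (2 * D) := by
        have : (1 : ℝ) ≤ ν := by linarith [(Nat.cast_nonneg k : (0 : ℝ) ≤ k)]
        nlinarith
      rw [hc]
      gcongr ?_ * ?_ * (4 * ?_)
      · calc (((k : ℝ) + 1) * (2 * D)) ^ (k + 1) ≤ (ν * (2 * D)) ^ (k + 1) := by gcongr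
          _ ≤ _ := pow_le_pow_right₀ h1 hk
      · exact pow_le_pow_right₀ (by linarith) hk
      · exact pow_le_pow_right₀ (by norm_num) hk
    have hrec : ((nontrivialPairs (k + 1) h s).card : ℝ) ≤
        (disjointPairs (k + 1) h s).card +
          ((k : ℝ) + 1) ^ 2 * (h * (nontrivialPairs k h s).card) := by
      exact_mod_cast card_nontrivialPairs_succ_le k h s
    have hone : (1 : ℝ) ≤ (ν ^ 2 + 1) ^ k := one_le_pow₀ (by nlinarith)
    calc ((nontrivialPairs (k + 1) h s).card : ℝ) * q.scaledMahlerMeasure h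
        ≤ ((disjointPairs (k + 1) h s).card +
          ((k : ℝ) + 1) ^ 2 * (h * (nontrivialPairs k h s).card)) * q.scaledMahlerMeasure h := by
          gcongr
      _ = (disjointPairs (k + 1) h s).card * q.scaledMahlerMeasure h + ((k : ℝ) + 1) ^ 2 * h *
          ((nontrivialPairs k h s).card * q.scaledMahlerMeasure h) := by ring
      _ ≤ c * h ^ (k + 2) + (ν : ℝ) ^ 2 * h * (c * (ν ^ 2 + 1) ^ k * h ^ (k + 1)) := by
          refine add_le_add (hdis.trans (mul_le_mul_of_nonneg_right hck (by positivity))) ?_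
          gcongr
      _ ≤ c * (ν ^ 2 + 1) ^ k * h ^ (k + 2) +
          (ν : ℝ) ^ 2 * h * (c * (ν ^ 2 + 1) ^ k * h ^ (k + 1)) := by
          gcongr
          exact le_mul_of_one_le_right hc0 hone
      _ = c * (ν ^ 2 + 1) ^ (k + 1) * h ^ (k + 1 + 1) := by ring

open Classical in
/-- Pairs of points of the cube with the same underlying multiset. -/
noncomputable def trivialPairs (k h : ℕ) : Finset ((Fin k → ℤ) × (Fin k → ℤ)) :=
  (intBox k h ×ˢ intBox k h).filter fun xy => diffPoly xy.1 xy.2 = 0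

theorem mem_trivialPairs {k h : ℕ} {xy : (Fin k → ℤ) × (Fin k → ℤ)} :
    xy ∈ trivialPairs k h ↔ (xy.1 ∈ intBox k h ∧ xy.2 ∈ intBox k h) ∧
      diffPoly xy.1 xy.2 = 0 := by
  rw [trivialPairs, Finset.mem_filter, Finset.mem_product]

theorem card_trivialPairs_le (k h : ℕ) : (trivialPairs k h).card ≤ k.factorial * h ^ k := by
  classical
  induction k with
  | zero =>
    rw [Nat.factorial_zero, pow_zero, one_mul]
    exact Finset.card_le_one.mpr fun a _ b _ => Subsingleton.elim a b
  | succ k ih =>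
    set U := (Finset.univ : Finset (Fin (k + 1))).biUnion fun j =>
      (trivialPairs (k + 1) h).filter fun xy => xy.1 0 = xy.2 j with hU
    have hsub : trivialPairs (k + 1) h ⊆ U := by
      intro xy hxy
      have h0 := eval_diffPoly_left xy.1 xy.2 0
      rw [(mem_trivialPairs.mp hxy).2, eval_zero, eq_comm, neg_eq_zero,
        Finset.prod_eq_zero_iff] at h0
      obtain ⟨j, -, hj⟩ := h0
      exact Finset.mem_biUnion.mpr ⟨j, Finset.mem_univ _,
        Finset.mem_filter.mpr ⟨hxy, sub_eq_zero.mp hj⟩⟩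
    calc (trivialPairs (k + 1) h).card ≤ U.card := Finset.card_le_card hsub
      _ ≤ ∑ _j : Fin (k + 1), h * (trivialPairs k h).card := by
          refine Finset.card_biUnion_le.trans (Finset.sum_le_sum fun j _ => ?_)
          refine card_le_mul_card_of_removal (i := 0) (j := j) fun xy hxy => ?_
          rw [Finset.mem_filter, mem_trivialPairs] at hxy
          obtain ⟨⟨⟨hx, hy⟩, h0⟩, hij⟩ := hxy
          rw [diffPoly_eq_mul hij] at h0
          exact ⟨hx, hij, mem_trivialPairs.mpr ⟨⟨intBox_removal hx _, intBox_removal hy _⟩,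
            (mul_eq_zero.mp h0).resolve_left (X_sub_C_ne_zero _)⟩⟩
      _ = (k + 1) * (h * (trivialPairs k h).card) := by simp
      _ ≤ (k + 1) * (h * (k.factorial * h ^ k)) := by gcongr
      _ = (k + 1).factorial * h ^ (k + 1) := by rw [Nat.factorial_succ]; ring

open Classical in
/-- Pairs of points of the cube such that the products `∏ (s - x i)` and `∏ (s - y i)` are equal
and do not vanish. -/
noncomputable def solutionPairs (k h : ℕ) (s : ℂ) : Finset ((Fin k → ℤ) × (Fin k → ℤ)) :=
  (intBox k h ×ˢ intBox k h).filter fun xy =>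
    aeval s (diffPoly xy.1 xy.2) = 0 ∧ ∀ i, s ≠ xy.1 i

theorem mem_solutionPairs {k h : ℕ} {s : ℂ} {xy : (Fin k → ℤ) × (Fin k → ℤ)} :
    xy ∈ solutionPairs k h s ↔ (xy.1 ∈ intBox k h ∧ xy.2 ∈ intBox k h) ∧
      aeval s (diffPoly xy.1 xy.2) = 0 ∧ ∀ i, s ≠ xy.1 i := by
  rw [solutionPairs, Finset.mem_filter, Finset.mem_product]

theorem card_solutionPairs_le (k h : ℕ) (s : ℂ) :
    (solutionPairs k h s).card ≤ (nontrivialPairs k h s).card + k.factorial * h ^ k := by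
  classical
  have hsub : solutionPairs k h s ⊆ nontrivialPairs k h s ∪ trivialPairs k h := by
    intro xy hxy
    rw [mem_solutionPairs] at hxy
    rw [Finset.mem_union, mem_nontrivialPairs, mem_trivialPairs]
    by_cases h0 : diffPoly xy.1 xy.2 = 0
    · exact Or.inr ⟨hxy.1, h0⟩
    · exact Or.inl ⟨hxy.1, h0, hxy.2⟩
  refine (Finset.card_le_card hsub).trans ((Finset.card_union_le _ _).trans ?_)
  exact Nat.add_le_add_left (card_trivialPairs_le k h) _

theorem card_le_pow_of_determined_coord {k h : ℕ} (i : Fin (k + 1))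
    {A : Finset (Fin (k + 1) → ℤ)} (hA : A ⊆ intBox (k + 1) h)
    (hdet : ∀ x ∈ A, ∀ y ∈ A, (∀ l, x (i.succAbove l) = y (i.succAbove l)) → x i = y i) :
    A.card ≤ h ^ k := by
  rw [← card_intBox k h]
  refine Finset.card_le_card_of_injOn (fun x l => x (i.succAbove l))
    (fun x hx => intBox_removal (hA hx) i) ?_
  intro x hx y hy heq
  refine funext fun l => ?_
  rcases Fin.eq_self_or_eq_succAbove i l with rfl | ⟨m, rfl⟩
  · exact hdet x hx y hy (congrFun heq)
  · exact congrFun heq m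

open Classical in
/-- The points of the cube with pairwise distinct coordinates, all of them different from `s`. -/
noncomputable def distinctPoints (k h : ℕ) (s : ℂ) : Finset (Fin k → ℤ) :=
  (intBox k h).filter fun x => Function.Injective x ∧ ∀ i, s ≠ x i

theorem mem_distinctPoints {k h : ℕ} {s : ℂ} {x : Fin k → ℤ} :
    x ∈ distinctPoints k h s ↔ x ∈ intBox k h ∧ Function.Injective x ∧ ∀ i, s ≠ x i := by
  rw [distinctPoints, Finset.mem_filter]

theorem pow_le_card_distinctPoints_add (k h : ℕ) (s : ℂ) :
    h ^ (k + 1) ≤ (distinctPoints (k + 1) h s).card + 2 * (k + 1) ^ 2 * h ^ k := by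
  classical
  set G := distinctPoints (k + 1) h s with hG
  set U := ((Finset.univ : Finset (Fin (k + 1) × Fin (k + 1))).filter
    fun ij => ij.1 ≠ ij.2).biUnion fun ij => (intBox (k + 1) h).filter fun x => x ij.1 = x ij.2
    with hU
  set W := (Finset.univ : Finset (Fin (k + 1))).biUnion fun i =>
    (intBox (k + 1) h).filter fun x => s = x i with hW
  have hsub : intBox (k + 1) h ⊆ G ∪ (U ∪ W) := by
    intro x hx
    by_cases hxG : x ∈ G
    · exact Finset.mem_union_left _ hxG
    refine Finset.mem_union_right _ ?_
    rw [hG, mem_distinctPoints, not_and, not_and_or] at hxG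
    rcases hxG hx with hinj | hs
    · rw [Function.not_injective_iff] at hinj
      obtain ⟨i, j, hij, hne⟩ := hinj
      exact Finset.mem_union_left _ (Finset.mem_biUnion.mpr ⟨(i, j), by simpa using hne,
        Finset.mem_filter.mpr ⟨hx, hij⟩⟩)
    · push Not at hs
      obtain ⟨i, hi⟩ := hs
      exact Finset.mem_union_right _ (Finset.mem_biUnion.mpr ⟨i, Finset.mem_univ _,
        Finset.mem_filter.mpr ⟨hx, hi⟩⟩)
  have hUc : U.card ≤ (k + 1) ^ 2 * h ^ k := by
    refine (Finset.card_biUnion_le_card_mul _ _ (h ^ k) fun ij hij => ?_).trans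
      (Nat.mul_le_mul_right _ ?_)
    · refine card_le_pow_of_determined_coord ij.1 (Finset.filter_subset _ _) ?_
      intro x hx y hy heq
      obtain ⟨m, hm⟩ := Fin.exists_succAbove_eq (Finset.mem_filter.mp hij).2.symm
      rw [(Finset.mem_filter.mp hx).2, (Finset.mem_filter.mp hy).2, ← hm, heq]
    · refine (Finset.card_filter_le _ _).trans ?_
      simp [sq]
  have hWc : W.card ≤ (k + 1) * h ^ k := by
    refine (Finset.card_biUnion_le_card_mul _ _ (h ^ k) fun i _ => ?_).trans (by simp)
    refine card_le_pow_of_determined_coord i (Finset.filter_subset _ _) ?_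
    intro x hx y hy _
    have := (Finset.mem_filter.mp hx).2.symm.trans (Finset.mem_filter.mp hy).2
    exact_mod_cast this
  have h1 := Finset.card_le_card hsub
  rw [card_intBox] at h1
  have h2 := Finset.card_union_le G (U ∪ W)
  have h3 := Finset.card_union_le U W
  have h4 : (k + 1) * h ^ k ≤ (k + 1) ^ 2 * h ^ k :=
    Nat.mul_le_mul_right _ (Nat.le_self_pow two_ne_zero _)
  linarith

theorem factorial_mul_card_le_card_solutionPairs (k h : ℕ) (s : ℂ) :
    k.factorial * (distinctPoints k h s).card ≤ (solutionPairs k h s).card := by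
  classical
  set G := distinctPoints k h s with hG
  calc k.factorial * G.card = (G ×ˢ (Finset.univ : Finset (Equiv.Perm (Fin k)))).card := by
        rw [Finset.card_product, Finset.card_univ, Fintype.card_perm, Fintype.card_fin, mul_comm]
    _ ≤ _ := by
        refine Finset.card_le_card_of_injOn (fun xp => (xp.1, fun i => xp.1 (xp.2 i))) ?_ ?_
        · rintro ⟨x, p⟩ hxp
          rw [Finset.mem_coe, Finset.mem_product, hG, mem_distinctPoints] at hxp
          obtain ⟨⟨hx, -, hs⟩, -⟩ := hxp
          rw [Finset.mem_coe, mem_solutionPairs]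
          refine ⟨⟨hx, mem_intBox.mpr fun i => mem_intBox.mp hx (p i)⟩, ?_, hs⟩
          rw [aeval_diffPoly, sub_eq_zero]
          exact (Equiv.prod_comp p fun i => s - (x i : ℂ)).symm
        · rintro ⟨x, p⟩ hxp ⟨y, r⟩ - heq
          rw [Finset.mem_coe, Finset.mem_product, hG, mem_distinctPoints] at hxp
          rw [Prod.mk.injEq] at heq
          obtain ⟨rfl, h2⟩ := heq
          exact Prod.ext rfl (Equiv.ext fun i => hxp.1.2.1 (congrFun h2 i))

theorem abs_card_solutionPairs_sub_le (k h : ℕ) (s : ℂ) :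
    |((solutionPairs (k + 1) h s).card : ℝ) - (k + 1).factorial * (h : ℝ) ^ (k + 1)| ≤
      (nontrivialPairs (k + 1) h s).card +
        2 * (k + 1).factorial * ((k : ℝ) + 1) ^ 2 * (h : ℝ) ^ k := by
  have h1 := card_solutionPairs_le (k + 1) h s
  have h2 := factorial_mul_card_le_card_solutionPairs (k + 1) h s
  have h3 := Nat.mul_le_mul_left (k + 1).factorial (pow_le_card_distinctPoints_add k h s)
  have h4 : (k + 1).factorial * h ^ (k + 1) ≤
      (solutionPairs (k + 1) h s).card + 2 * (k + 1).factorial * (k + 1) ^ 2 * h ^ k := by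
    rw [mul_add] at h3
    linarith
  have h1' : ((solutionPairs (k + 1) h s).card : ℝ) ≤
    (nontrivialPairs (k + 1) h s).card + (k + 1).factorial * (h : ℝ) ^ (k + 1) := by
    exact_mod_cast h1
  have h4' : ((k + 1).factorial * (h : ℝ) ^ (k + 1)) ≤ (solutionPairs (k + 1) h s).card +
      2 * (k + 1).factorial * ((k : ℝ) + 1) ^ 2 * (h : ℝ) ^ k := by
    exact_mod_cast h4
  have h5 : (0 : ℝ) ≤ 2 * (k + 1).factorial * ((k : ℝ) + 1) ^ 2 * (h : ℝ) ^ k := by positivity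
  have h6 : (0 : ℝ) ≤ (nontrivialPairs (k + 1) h s).card := Nat.cast_nonneg _
  rw [abs_le]
  constructor <;> linarith

theorem coe_solutionPairs_neg (k h : ℕ) (σ : ℂ) :
    {xy : (Fin k → ℤ) × (Fin k → ℤ) | (∀ i, 1 ≤ xy.1 i ∧ xy.1 i ≤ (h : ℤ)) ∧
      (∀ i, 1 ≤ xy.2 i ∧ xy.2 i ≤ (h : ℤ)) ∧
      (∏ i, ((xy.1 i : ℂ) + σ)) = (∏ i, ((xy.2 i : ℂ) + σ)) ∧
      (∏ i, ((xy.1 i : ℂ) + σ)) ≠ 0} = solutionPairs k h (-σ) := by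
  have hneg : ∀ z : Fin k → ℤ,
      ∏ i, ((z i : ℂ) + σ) = (-1) ^ k * ∏ i, (-σ - z i) := by
    intro z
    have : ∀ i, (z i : ℂ) + σ = -(-σ - z i) := fun i => by ring
    simp_rw [this]
    rw [Finset.prod_neg]
    simp
  have hpow : ((-1 : ℂ) ^ k) ≠ 0 := pow_ne_zero _ (neg_ne_zero.mpr one_ne_zero)
  ext xy
  rw [Finset.mem_coe, mem_solutionPairs, mem_intBox, mem_intBox, aeval_diffPoly, Set.mem_ofPred_eq,
    hneg, hneg, mul_right_inj' hpow, sub_eq_zero, and_assoc]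
  refine and_congr_right fun _ => and_congr_right fun _ => and_congr_right fun _ => ?_
  rw [mul_ne_zero_iff_left hpow, Finset.prod_ne_zero_iff]
  simp [sub_ne_zero]

theorem card_nontrivialPairs_le {ν h D : ℕ} {s : ℂ} {q : ℤ[X]} {ε : ℝ}
    (hq : ∀ P : ℤ[X], aeval s P = 0 ↔ q ∣ P) (hh : 1 ≤ h) (hD1 : 1 ≤ D)
    (hD : ∀ n : ℕ, n ≠ 0 → n ≤ h ^ (ν * ν) → n.divisors.card ≤ D)
    (hM : q ≠ 0 → (h : ℝ) ^ (1 + ε / 2) ≤ q.scaledMahlerMeasure h) :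
    ((nontrivialPairs ν h s).card : ℝ) ≤
      (ν * 2) ^ ν * 2 ^ ν * (4 * 4 ^ ν) * (ν ^ 2 + 1) ^ ν * (D : ℝ) ^ (2 * ν) *
        (h : ℝ) ^ ((ν : ℝ) - ε / 2) := by
  have hh0 : (0 : ℝ) < h := by exact_mod_cast hh
  rcases eq_or_ne q 0 with rfl | hq0
  · have : nontrivialPairs ν h s = ∅ := by
      refine Finset.eq_empty_of_forall_notMem fun xy hxy => ?_
      obtain ⟨-, hne, hs, -⟩ := mem_nontrivialPairs.mp hxy
      exact hne (zero_dvd_iff.mp ((hq _).mp hs))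
    rw [this, Finset.card_empty, Nat.cast_zero]
    positivity
  have key := card_nontrivialPairs_mul_le hq hh hD1 hD le_rfl
  have hP : (0 : ℝ) < (h : ℝ) ^ (1 + ε / 2) := Real.rpow_pos_of_pos hh0 _
  have hsplit : (h : ℝ) ^ (ν + 1) = (h : ℝ) ^ ((ν : ℝ) - ε / 2) * (h : ℝ) ^ (1 + ε / 2) := by
    rw [← Real.rpow_add hh0, ← Real.rpow_natCast]
    congr 1
    push_cast
    ring
  refine le_of_mul_le_mul_right ?_ hP
  calc ((nontrivialPairs ν h s).card : ℝ) * (h : ℝ) ^ (1 + ε / 2)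
      ≤ (nontrivialPairs ν h s).card * q.scaledMahlerMeasure h := by
        gcongr
        exact hM hq0
    _ ≤ _ := key
    _ = _ := by
        rw [hsplit, ← mul_assoc (ν : ℝ) 2, mul_pow _ (D : ℝ), mul_pow _ (D : ℝ)]
        ring

theorem exists_abs_card_solutionPairs_sub_le {ν : ℕ} (hν : 1 ≤ ν) :
    ∃ C : ℝ, 0 < C ∧ ∀ h : ℕ, 3 ≤ h → ∀ ε : ℝ, ε ≤ 2 → ∀ (s : ℂ) (q : ℤ[X]),
      (∀ P : ℤ[X], aeval s P = 0 ↔ q ∣ P) →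
      (q ≠ 0 → (h : ℝ) ^ (1 + ε / 2) ≤ q.scaledMahlerMeasure h) →
      |((solutionPairs ν h s).card : ℝ) - ν.factorial * (h : ℝ) ^ ν| ≤
        (h : ℝ) ^ ((ν : ℝ) - ε / 2) * Real.exp (C * Real.log h / Real.log (Real.log h)) := by
  obtain ⟨c, hc, hdiv⟩ := exists_card_divisors_le (ν * ν)
  set a : ℝ := (ν * 2) ^ ν * 2 ^ ν * (4 * 4 ^ ν) * (ν ^ 2 + 1) ^ ν with ha
  set b : ℝ := 2 * ν.factorial * (ν : ℝ) ^ 2 with hb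
  have ha0 : 0 ≤ a := by positivity
  have hb0 : 0 ≤ b := by positivity
  refine ⟨a + b + 2 * ν * c, by positivity, ?_⟩
  intro h hh ε hε s q hq hM
  have hh1 : (1 : ℝ) ≤ h := by exact_mod_cast (by omega : 1 ≤ h)
  have hh0 : (0 : ℝ) < h := by linarith
  have hlog := one_lt_log_natCast hh
  have hloglog := Real.log_pos hlog
  set w := Real.log h / Real.log (Real.log h) with hw
  have hw1 : 1 ≤ w := by
    rw [hw, one_le_div hloglog]
    exact Real.log_le_self (by linarith)
  set D := ⌊Real.exp (c * w)⌋₊ with hDdef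
  have hD1 : 1 ≤ D := Nat.one_le_floor_iff _ |>.mpr (Real.one_le_exp (by positivity))
  have hDe : (D : ℝ) ≤ Real.exp (c * w) := Nat.floor_le (Real.exp_pos _).le
  have hT := card_nontrivialPairs_le hq (by omega) hD1
    (fun n hn hnh => Nat.le_floor (hdiv h hh n hn hnh)) hM
  obtain ⟨k, rfl⟩ : ∃ k, ν = k + 1 := ⟨ν - 1, by omega⟩
  have hpow : (h : ℝ) ^ k ≤ (h : ℝ) ^ (((k + 1 : ℕ) : ℝ) - ε / 2) := by
    rw [← Real.rpow_natCast]
    refine Real.rpow_le_rpow_of_exponent_le hh1 ?_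
    push_cast
    linarith
  have hDpow : (D : ℝ) ^ (2 * (k + 1)) ≤ Real.exp (2 * ((k + 1 : ℕ) : ℝ) * c * w) := by
    calc (D : ℝ) ^ (2 * (k + 1)) ≤ Real.exp (c * w) ^ (2 * (k + 1)) := by gcongr
      _ = _ := by
        rw [← Real.exp_nat_mul]
        congr 1
        push_cast
        ring
  have hE1 : (1 : ℝ) ≤ Real.exp (2 * ((k + 1 : ℕ) : ℝ) * c * w) :=
    Real.one_le_exp (by positivity)
  set H := (h : ℝ) ^ (((k + 1 : ℕ) : ℝ) - ε / 2) with hH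
  have hH0 : 0 ≤ H := by positivity
  set E := Real.exp (2 * ((k + 1 : ℕ) : ℝ) * c * w) with hE
  have hab : a + b ≤ Real.exp ((a + b) * w) := by
    have h1 : a + b ≤ (a + b) * w := le_mul_of_one_le_right (by positivity) hw1
    linarith [Real.add_one_le_exp ((a + b) * w)]
  calc _ ≤ ((nontrivialPairs (k + 1) h s).card : ℝ) +
        2 * (k + 1).factorial * ((k : ℝ) + 1) ^ 2 * (h : ℝ) ^ k :=
        abs_card_solutionPairs_sub_le k h s
    _ ≤ a * E * H + b * E * H := by
        refine add_le_add (hT.trans ?_) ?_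
        · gcongr
        · calc 2 * (k + 1).factorial * ((k : ℝ) + 1) ^ 2 * (h : ℝ) ^ k = b * 1 * (h : ℝ) ^ k := by
                rw [hb]
                push_cast
                ring
            _ ≤ b * E * H := by gcongr
    _ = H * ((a + b) * E) := by ring
    _ ≤ H * (Real.exp ((a + b) * w) * E) := by gcongr
    _ = _ := by
        rw [hE, ← Real.exp_add, mul_div_assoc, ← hw]
        congr 2
        ring

theorem rational_points_finite_and_ncard_le {h : ℕ} {ε : ℝ} (hh : 1 ≤ h) (hε : 0 < ε) {S : Set ℂ}
    (hS : ∀ σ ∈ S, ∃ a b : ℤ, |(a : ℝ)| ≤ (h : ℝ) ^ (1 + ε / 2) ∧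
      |(b : ℝ)| ≤ (h : ℝ) ^ (ε / 2) ∧ σ = a / b) :
    S.Finite ∧ (S.ncard : ℝ) ≤ 9 * (h : ℝ) ^ (1 + ε) := by
  classical
  have hh1 : (1 : ℝ) ≤ h := by exact_mod_cast hh
  have habs : ∀ (n : ℤ) (t : ℝ), |(n : ℝ)| ≤ t → n ∈ Finset.Icc (-(⌊t⌋₊ : ℤ)) ⌊t⌋₊ := by
    intro n t hn
    rw [Finset.mem_Icc, ← abs_le, Int.abs_eq_natAbs, Nat.cast_le]
    refine Nat.le_floor ?_
    rwa [← Int.cast_abs, Int.abs_eq_natAbs, Int.cast_natCast] at hn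
  have hcard : ∀ t : ℝ, 1 ≤ t → ((Finset.Icc (-(⌊t⌋₊ : ℤ)) ⌊t⌋₊).card : ℝ) ≤ 3 * t := by
    intro t ht
    have h1 : (Finset.Icc (-(⌊t⌋₊ : ℤ)) ⌊t⌋₊).card = 2 * ⌊t⌋₊ + 1 := by
      rw [Int.card_Icc]
      omega
    have h2 := Nat.floor_le (by linarith : 0 ≤ t)
    rw [h1]
    push_cast
    linarith
  set A := (h : ℝ) ^ (1 + ε / 2) with hA
  set B := (h : ℝ) ^ (ε / 2) with hB
  have hA1 : 1 ≤ A := Real.one_le_rpow hh1 (by positivity)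
  have hB1 : 1 ≤ B := Real.one_le_rpow hh1 (by positivity)
  set F : Finset ℂ := (Finset.Icc (-(⌊A⌋₊ : ℤ)) ⌊A⌋₊ ×ˢ Finset.Icc (-(⌊B⌋₊ : ℤ)) ⌊B⌋₊).image
    fun ab => (ab.1 : ℂ) / ab.2 with hF
  have hsub : S ⊆ F := by
    intro σ hσ
    obtain ⟨a, b, ha, hb, rfl⟩ := hS σ hσ
    rw [Finset.mem_coe, hF, Finset.mem_image]
    exact ⟨(a, b), Finset.mem_product.mpr ⟨habs a _ ha, habs b _ hb⟩, rfl⟩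
  refine ⟨F.finite_toSet.subset hsub, ?_⟩
  have h1 : S.ncard ≤ F.card := by
    rw [← Set.ncard_coe_finset]
    exact Set.ncard_le_ncard hsub F.finite_toSet
  have h2 := h1.trans Finset.card_image_le
  rw [Finset.card_product] at h2
  calc (S.ncard : ℝ) ≤ (Finset.Icc (-(⌊A⌋₊ : ℤ)) ⌊A⌋₊).card *
        (Finset.Icc (-(⌊B⌋₊ : ℤ)) ⌊B⌋₊).card := by exact_mod_cast h2
    _ ≤ (3 * A) * (3 * B) := by
        gcongr
        · exact hcard A hA1
        · exact hcard B hB1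
    _ = 9 * (h : ℝ) ^ (1 + ε) := by
        rw [show 1 + ε = (1 + ε / 2) + ε / 2 by ring, Real.rpow_add (by linarith) (1 + ε / 2),
          ← hA, ← hB]
        ring

end

/-- For fixed `ν ≥ 1` and `0 < ε ≤ 2`, there are `C₁, C₂ > 0` such that for every
`h ≥ 3`, the set of `σ ∈ ℂ` with `|K_ν(h,σ) − ν!·h^ν| > h^{ν−ε/2} exp(C₁ log h/log log h)`
is finite of cardinality at most `C₂·h^{1+ε}`. -/
theorem stmt4 (ν : ℕ) (hν : 1 ≤ ν) (ε : ℝ) (hε : 0 < ε) (hε2 : ε ≤ 2) :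
    ∃ C₁ C₂ : ℝ, 0 < C₁ ∧ 0 < C₂ ∧ ∀ h : ℕ, 3 ≤ h →
      ({σ : ℂ |
        |(Set.ncard {xy : (Fin ν → ℤ) × (Fin ν → ℤ) |
            (∀ i, 1 ≤ xy.1 i ∧ xy.1 i ≤ (h : ℤ)) ∧
            (∀ i, 1 ≤ xy.2 i ∧ xy.2 i ≤ (h : ℤ)) ∧
            (∏ i, ((xy.1 i : ℂ) + σ)) = (∏ i, ((xy.2 i : ℂ) + σ)) ∧
            (∏ i, ((xy.1 i : ℂ) + σ)) ≠ 0} : ℝ) - (Nat.factorial ν : ℝ) * (h : ℝ) ^ ν| >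
          (h : ℝ) ^ ((ν : ℝ) - ε / 2) *
            Real.exp (C₁ * Real.log h / Real.log (Real.log h))}).Finite ∧
      (Set.ncard {σ : ℂ |
        |(Set.ncard {xy : (Fin ν → ℤ) × (Fin ν → ℤ) |
            (∀ i, 1 ≤ xy.1 i ∧ xy.1 i ≤ (h : ℤ)) ∧
            (∀ i, 1 ≤ xy.2 i ∧ xy.2 i ≤ (h : ℤ)) ∧
            (∏ i, ((xy.1 i : ℂ) + σ)) = (∏ i, ((xy.2 i : ℂ) + σ)) ∧
            (∏ i, ((xy.1 i : ℂ) + σ)) ≠ 0} : ℝ) - (Nat.factorial ν : ℝ) * (h : ℝ) ^ ν| >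
          (h : ℝ) ^ ((ν : ℝ) - ε / 2) *
            Real.exp (C₁ * Real.log h / Real.log (Real.log h))} : ℝ)
        ≤ C₂ * (h : ℝ) ^ ((1 : ℝ) + ε) := by
  obtain ⟨C, hC, hmain⟩ := exists_abs_card_solutionPairs_sub_le hν
  refine ⟨C, 9, hC, by norm_num, fun h hh => ?_⟩
  refine rational_points_finite_and_ncard_le (by omega) hε fun σ hσ => ?_
  have hh1 : (1 : ℝ) ≤ h := by exact_mod_cast (by omega : 1 ≤ h)
  have hh0 : (0 : ℝ) < h := by linarith
  rw [Set.mem_ofPred_eq, coe_solutionPairs_neg, Set.ncard_coe_finset] at hσ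
  obtain ⟨q, hq⟩ := exists_aeval_eq_zero_iff_dvd (-σ)
  have hM : ¬(q ≠ 0 → (h : ℝ) ^ (1 + ε / 2) ≤ q.scaledMahlerMeasure h) :=
    fun hM => hσ.not_ge (hmain h hh ε hε2 _ q hq hM)
  push Not at hM
  obtain ⟨hq0, hM⟩ := hM
  have hM2 : q.scaledMahlerMeasure h < (h : ℝ) ^ 2 := by
    refine hM.trans_le ?_
    rw [← Real.rpow_natCast]
    refine Real.rpow_le_rpow_of_exponent_le hh1 ?_
    push_cast
    linarith
  obtain ⟨a, b, ha, hb, hab⟩ := exists_rational_root_of_scaledMahlerMeasure_lt (by omega) hq0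
    ((hq q).mpr dvd_rfl) hM2
  refine ⟨-a, b, ?_, ?_, ?_⟩
  · rw [Int.cast_neg, abs_neg]
    exact ha.trans hM.le
  · refine le_of_mul_le_mul_right ((hb.trans hM.le).trans_eq ?_) hh0
    rw [add_comm, Real.rpow_add_one hh0.ne']
  · rw [← neg_neg σ, hab]
    push_cast
    ring
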